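/- Let I be a type, let p and q be conditions of Coh(I, ω), and let E ⊆ ℕ be a finite set such that p and q are compatible on all rows in E, i.e. for every n ∈ E and every i ∈ I, p(n,i) = none, or q(n,i) = none, or p(n,i) = q(n,i). Then there exists a finitary permutation π of ℕ with π n = n for all n ∈ E such that π • p and q are compatible. -/

import Mathlib

/-- A condition of the forcing `Coh(I, ω)`: a function `ℕ × I → Option Bool`
with finite support. -/
def CohCond (I : Type*) : Type _ := {p : ℕ × I → Option Bool // {x | p x ≠ none}.Finite}

/-- A permutation `π` of `ℕ` acts on a condition by permuting the first
coordinate: `(π • p)(n, i) = p (π⁻¹ n, i)`. -/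
instance {I : Type*} : SMul (Equiv.Perm ℕ) (CohCond I) :=
  ⟨fun π p => ⟨fun x => p.1 (π⁻¹ x.1, x.2), by
    apply Set.Finite.subset (p.2.image (fun x => (π x.1, x.2)))
    rintro ⟨n, i⟩ hx
    exact ⟨(π⁻¹ n, i), hx, by simp⟩⟩⟩

/-- Two conditions of `Coh(I, ω)` are compatible if they agree wherever both
are defined. -/
def Compatible {I : Type*} (p q : CohCond I) : Prop :=
  ∀ x : ℕ × I, p.1 x = none ∨ q.1 x = none ∨ p.1 x = q.1 x

/-- The involution of `ℕ` exchanging `n` and `n + N` for every `n < N` outside `E`. -/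
def shiftSwap (E : Finset ℕ) (N n : ℕ) : ℕ :=
  if n < N ∧ n ∉ E then n + N
  else if N ≤ n ∧ n < 2 * N ∧ n - N ∉ E then n - N
  else n

theorem shiftSwap_involutive (E : Finset ℕ) (N : ℕ) : Function.Involutive (shiftSwap E N) := by
  intro n
  unfold shiftSwap
  grind

theorem shiftSwap_of_two_mul_le (E : Finset ℕ) {N n : ℕ} (h : 2 * N ≤ n) :
    shiftSwap E N n = n := by
  grind [shiftSwap]

theorem shiftSwap_of_mem {E : Finset ℕ} {N n : ℕ} (hn : n < N) (h : n ∈ E) :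
    shiftSwap E N n = n := by
  grind [shiftSwap]

theorem shiftSwap_of_notMem {E : Finset ℕ} {N n : ℕ} (hn : n < N) (h : n ∉ E) :
    shiftSwap E N n = n + N := by
  grind [shiftSwap]

theorem CohCond.exists_forall_ge_eq_none {I : Type*} (p : CohCond I) :
    ∃ N, ∀ n, N ≤ n → ∀ i, p.1 (n, i) = none := by
  obtain ⟨N, hN⟩ := (p.2.image Prod.fst).bddAbove
  refine ⟨N + 1, fun n hn i => by_contra fun h => ?_⟩
  have : n ≤ N := hN ⟨(n, i), h, rfl⟩
  omega

/-- if two conditions `p, q` of `Coh(I, ω)` are compatible on all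
rows in a finite set `E ⊆ ℕ`, then there is a finitary permutation `π` of `ℕ`
fixing `E` pointwise such that `π • p` and `q` are compatible. -/
theorem coh_homogeneous_fixing_rows {I : Type*} (p q : CohCond I) (E : Finset ℕ)
    (hE : ∀ n ∈ E, ∀ i : I, p.1 (n, i) = none ∨ q.1 (n, i) = none ∨
      p.1 (n, i) = q.1 (n, i)) :
    ∃ π : Equiv.Perm ℕ, {n | π n ≠ n}.Finite ∧ (∀ n ∈ E, π n = n) ∧
      Compatible (π • p) q := by
  obtain ⟨a, ha⟩ := p.exists_forall_ge_eq_none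
  obtain ⟨b, hb⟩ := q.exists_forall_ge_eq_none
  obtain ⟨c, hc⟩ := E.bddAbove
  obtain ⟨N, haN, hbN, hcN⟩ : ∃ N, a ≤ N ∧ b ≤ N ∧ c < N := ⟨a + b + c + 1, by omega⟩
  have hEN : ∀ n ∈ E, n < N := fun n hn => (hc hn).trans_lt hcN
  refine ⟨(shiftSwap_involutive E N).toPerm, ?_, ?_, ?_⟩
  · refine (Set.finite_lt_nat (2 * N)).subset fun n hn => ?_
    by_contra h
    exact hn (shiftSwap_of_two_mul_le E (not_lt.mp h))
  · exact fun n hn => shiftSwap_of_mem (hEN n hn) hn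
  · rintro ⟨n, i⟩
    change p.1 (shiftSwap E N n, i) = none ∨ q.1 (n, i) = none ∨
      p.1 (shiftSwap E N n, i) = q.1 (n, i)
    by_cases hn : n ∈ E
    · rw [shiftSwap_of_mem (hEN n hn) hn]
      exact hE n hn i
    · rcases lt_or_ge n N with h | h
      · left
        rw [shiftSwap_of_notMem h hn]
        exact ha _ (by omega) i
      · exact Or.inr (Or.inl (hb n (by omega) i))
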